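/- arXiv:2602.02373 — 4 statements merged into one kernel-verified Lean document; each statement's English description precedes it below -/
import Mathlib

section
/- Let n ≥ 3 be an integer, δ ∈ (0,1), p : Fin n → ℝ and Ψ ∈ ℝ. Assume the Kasner relations ∑_I p I = 1 and ∑_I (p I)^2 + Ψ^2 = 1, and assume the subcritical condition: p I + p J − p K < 1 − 2δ for all indices I, J, K with I ≠ J. Then |p I| < 1 − 2δ for every index I. -/
/-- Pointwise algebraic content of Lemma "bounds for the pI": Kasner exponents
satisfying the Kasner relations and the subcritical condition obey `|p I| < 1 - 2δ`. -/
theorem stmt_0 (n : ℕ) (hn : 3 ≤ n) (δ Ψ : ℝ) (hδ0 : 0 < δ) (hδ1 : δ < 1)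
    (p : Fin n → ℝ)
    (hsum : ∑ I, p I = 1)
    (hsq : ∑ I, (p I) ^ 2 + Ψ ^ 2 = 1)
    (hsub : ∀ I J K : Fin n, I ≠ J → p I + p J - p K < 1 - 2 * δ) :
    ∀ I : Fin n, |p I| < 1 - 2 * δ := by
  have : Nontrivial (Fin n) := Fin.nontrivial_iff_two_le.mpr (by omega)
  have upper : ∀ I, p I < 1 - 2 * δ := fun I ↦ by
    obtain ⟨J, hJ⟩ := exists_ne I
    linarith [hsub I J J hJ.symm]
  obtain ⟨M, -, hM⟩ : ∃ M ∈ Finset.univ, 0 < p M := by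
    by_contra! h
    linarith [Finset.sum_nonpos h]
  obtain ⟨J, hJ, hJpos⟩ : ∃ J ∈ Finset.univ.erase M, 0 < p J := by
    by_contra! h
    linarith [Finset.sum_nonpos h, upper M, Finset.add_sum_erase _ p (Finset.mem_univ M)]
  intro I
  rw [abs_lt]
  exact ⟨by linarith [hsub J M I (Finset.ne_of_mem_erase hJ)], upper I⟩
end

section
/- Let Σ be a compact topological space, n ≥ 3 an integer, δ > 0, and let p I : Σ → ℝ be continuous functions for I = 1,…,n. Then there exist a natural number N ≥ 1, open sets U_1,…,U_N ⊆ Σ with Σ = ⋃_j U_j, and real numbers α_1,…,α_N with 0 < α_j ≤ δ/4, such that for every j, every x ∈ U_j, every integer m, all indices I, J, K with I ≠ J, and every index I, the following hold: |−1 + p I(x) + p J(x) − p K(x) + m·δ + α_j| ≥ α_j/2 and |−1 − p I(x) + m·δ + α_j| ≥ α_j/2. -/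
open Filter Topology in
theorem eventually_le_abs_add_int_mul_add {δ : ℝ} (hδ : 0 < δ) (a : ℝ) :
    ∀ᶠ α in 𝓝[>] (0 : ℝ), ∀ m : ℤ, α ≤ |a + m * δ + α| := by
  have hfloor : ⌊a / δ⌋ * δ ≤ a := (le_div_iff₀ hδ).1 (Int.floor_le _)
  have hlt : a < (⌊a / δ⌋ + 1) * δ := (div_lt_iff₀ hδ).1 (Int.lt_floor_add_one _)
  have hpos : 0 < ((⌊a / δ⌋ + 1) * δ - a) / 2 := by linarith
  filter_upwards [Ioc_mem_nhdsGT hpos] with α hα m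
  obtain ⟨hα0, hα1⟩ := hα
  rcases le_or_gt 0 (m + ⌊a / δ⌋) with h | h
  · have h' : (0 : ℝ) ≤ m + ⌊a / δ⌋ := by exact_mod_cast h
    exact le_abs.2 (Or.inl (by nlinarith [mul_nonneg h' hδ.le]))
  · have h' : (m : ℝ) + ⌊a / δ⌋ + 1 ≤ 0 := by exact_mod_cast h
    exact le_abs.2 (Or.inr (by nlinarith [mul_nonneg (neg_nonneg.2 h') hδ.le]))

open Filter Topology in
theorem exists_finite_open_cover_half_le_abs {X ι : Type*} [TopologicalSpace X] [CompactSpace X]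
    [Finite ι] {δ : ℝ} (hδ : 0 < δ) (f : ι → X → ℝ) (hf : ∀ i, Continuous (f i)) :
    ∃ (N : ℕ) (U : Fin N → Set X) (α : Fin N → ℝ),
      1 ≤ N ∧ (∀ j, IsOpen (U j)) ∧ (⋃ j, U j) = Set.univ ∧
      (∀ j, 0 < α j ∧ α j ≤ δ / 4) ∧
      ∀ j, ∀ x ∈ U j, ∀ (m : ℤ) (i : ι), α j / 2 ≤ |f i x + m * δ + α j| := by
  rcases isEmpty_or_nonempty X with hX | hX
  · exact ⟨1, fun _ => Set.univ, fun _ => δ / 4, le_rfl, fun _ => isOpen_univ,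
      Set.iUnion_const _, fun _ => ⟨by positivity, le_rfl⟩, fun _ x => isEmptyElim x⟩
  have hα (x : X) : ∃ α : ℝ, (0 < α ∧ α ≤ δ / 4) ∧
      ∀ (i : ι) (m : ℤ), α ≤ |f i x + m * δ + α| := by
    have hδ4 : 0 < δ / 4 := by positivity
    exact (Eventually.and (Ioc_mem_nhdsGT hδ4)
      (eventually_all.2 fun i => eventually_le_abs_add_int_mul_add hδ (f i x))).exists
  choose α hα hfα using hα
  let V (x : X) : Set X := {y | ∀ i, |f i y - f i x| < α x / 2}
  have hVo (x : X) : IsOpen (V x) := by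
    simp only [V, Set.ofPred_forall]
    exact isOpen_iInter_of_finite fun i =>
      isOpen_lt ((hf i).sub continuous_const).abs continuous_const
  have hxV (x : X) : x ∈ V x := fun i => by simpa using (hα x).1
  obtain ⟨t, -, ht⟩ := isCompact_univ.elim_nhds_subcover V
    fun x _ => (hVo x).mem_nhds (hxV x)
  have hcover (y : X) : ∃ x ∈ t, y ∈ V x := by simpa using ht (Set.mem_univ y)
  refine ⟨t.card, fun j => V (t.equivFin.symm j), fun j => α (t.equivFin.symm j), ?_,
    fun _ => hVo _, ?_, fun _ => hα _, ?_⟩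
  · obtain ⟨x, hx, -⟩ := hcover hX.some
    exact Finset.card_pos.2 ⟨x, hx⟩
  · refine Set.eq_univ_of_forall fun y => ?_
    obtain ⟨x, hx, hy⟩ := hcover y
    exact Set.mem_iUnion.2 ⟨t.equivFin ⟨x, hx⟩, by simpa using hy⟩
  · intro j y hy m i
    set x : X := (t.equivFin.symm j).1
    have h := abs_sub_abs_le_abs_sub (f i x + m * δ + α x) (f i y + m * δ + α x)
    rw [show f i x + m * δ + α x - (f i y + m * δ + α x) = -(f i y - f i x) by ring,
      abs_neg] at h
    linarith [hy i, hfα x i m]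

/-- The paper's "technical lemma" (Lemma 3.4): for continuous functions `p I` on a
compact space `X`, there is a finite open cover `U j` and constants `α j ∈ (0, δ/4]`
such that the listed quantities stay at distance at least `α j / 2` from `0` on `U j`,
for all integer multiples `m • δ` of `δ`. -/
theorem stmt_1 {X : Type*} [TopologicalSpace X] [CompactSpace X]
    (n : ℕ) (hn : 3 ≤ n) (δ : ℝ) (hδ : 0 < δ)
    (p : Fin n → X → ℝ) (hp : ∀ I, Continuous (p I)) :
    ∃ (N : ℕ) (U : Fin N → Set X) (α : Fin N → ℝ),
      1 ≤ N ∧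
      (∀ j, IsOpen (U j)) ∧
      (⋃ j, U j) = Set.univ ∧
      (∀ j, 0 < α j ∧ α j ≤ δ / 4) ∧
      (∀ j, ∀ x ∈ U j, ∀ m : ℤ,
        (∀ I J K : Fin n, I ≠ J →
          |(-1 : ℝ) + p I x + p J x - p K x + m * δ + α j| ≥ α j / 2) ∧
        (∀ I : Fin n, |(-1 : ℝ) - p I x + m * δ + α j| ≥ α j / 2)) := by
  let f : (Fin n × Fin n × Fin n) ⊕ Fin n → X → ℝ :=
    Sum.elim (fun q x => -1 + p q.1 x + p q.2.1 x - p q.2.2 x) (fun I x => -1 - p I x)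
  have hf : ∀ i, Continuous (f i) := by
    rintro (q | I) <;> simp only [f, Sum.elim_inl, Sum.elim_inr] <;> fun_prop
  obtain ⟨N, U, α, hN, hU, hcover, hα, h⟩ := exists_finite_open_cover_half_le_abs hδ f hf
  exact ⟨N, U, α, hN, hU, hcover, hα, fun j x hx m =>
    ⟨fun I J K _ => h j x hx m (Sum.inl (I, J, K)), fun I => h j x hx m (Sum.inr I)⟩⟩
end

section
/- Let k be a natural number, a : Fin k → ℝ a finite family of real numbers, and δ > 0. Then there exists a real number α with 0 < α ≤ δ/4 such that for every index i and every integer m one has |a i − m·δ − α| ≥ α. -/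
/-- The representative of `x` modulo `δ` in `(0, δ]` is the least positive element of the
class `x + ℤ δ`. -/
lemma toIocMod_zero_le_sub_intCast_mul {δ : ℝ} (hδ : 0 < δ) {x : ℝ} {m : ℤ}
    (h : 0 < x - m * δ) : toIocMod hδ 0 x ≤ x - m * δ := by
  have hle : toIocMod hδ 0 x ≤ δ := by simpa using toIocMod_le_right hδ 0 x
  have hx : toIocMod hδ 0 x + toIocDiv hδ 0 x * δ = x := by simp
  have hm : m ≤ toIocDiv hδ 0 x := by
    by_contra! hlt
    have : (toIocDiv hδ 0 x : ℝ) + 1 ≤ m := by exact_mod_cast hlt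
    nlinarith
  have : (m : ℝ) ≤ toIocDiv hδ 0 x := by exact_mod_cast hm
  nlinarith

/-- Real-number core of the "technical lemma": finitely many real numbers can be
simultaneously shifted by some `α ∈ (0, δ/4]` so as to stay at distance at least `α`
from every integer multiple of `δ`. -/
theorem stmt_2 (k : ℕ) (a : Fin k → ℝ) (δ : ℝ) (hδ : 0 < δ) :
    ∃ α : ℝ, 0 < α ∧ α ≤ δ / 4 ∧ ∀ (i : Fin k) (m : ℤ), |a i - m * δ - α| ≥ α := by
  have hsmall {c : ℝ} (hc : 0 < c) : ∀ᶠ α in nhdsWithin (0 : ℝ) (Set.Ioi 0), α < c :=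
    nhdsWithin_le_nhds (Iio_mem_nhds hc)
  have hpos (i : Fin k) : 0 < toIocMod hδ 0 (a i) := left_lt_toIocMod hδ 0 (a i)
  obtain ⟨α, hα, hαδ, hαa⟩ := (eventually_mem_nhdsWithin.and ((hsmall (by positivity : 0 < δ / 4)).and
    (Filter.eventually_all.2 fun i => hsmall (half_pos (hpos i))))).exists
  refine ⟨α, hα, hαδ.le, fun i m => ?_⟩
  rcases le_or_gt (a i - m * δ) 0 with h | h
  · exact le_abs.2 (Or.inr (by linarith))
  · exact le_abs.2 (Or.inl (by linarith [toIocMod_zero_le_sub_intCast_mul hδ h, hαa i]))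
end

section
/- Let n ≥ 1 be an integer, t₀ > 0, δ > 0, and C ≥ 0. Let A : (0,t₀] → Matrix (Fin n) (Fin n) ℝ be such that every entry t ↦ (A t) I J is differentiable on (0,t₀], A(t)ᵀ · A(t) = 1 (the identity matrix) for every t ∈ (0,t₀], and |∂ₜ (A t) I J| ≤ C · t^(2δ−1) for all t ∈ (0,t₀] and all entries I, J. Then there exists a matrix Å ∈ Matrix (Fin n) (Fin n) ℝ with Åᵀ · Å = 1 such that |(A t) I J − Å I J| ≤ (C/(2δ)) · t^(2δ) for all t ∈ (0,t₀] and all entries I, J. -/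
open Matrix

open Filter Topology

section PowerDerivativeBound

variable {E : Type*} [NormedAddCommGroup E] [NormedSpace ℝ E] {f f' : ℝ → E} {t₀ p C : ℝ}

/-- The mean value inequality for a derivative bounded by a multiple of `t ^ (p - 1)`. -/
lemma norm_sub_le_of_norm_deriv_le_rpow (hp : 0 < p)
    (hf : ∀ t ∈ Set.Ioc 0 t₀, HasDerivWithinAt f (f' t) (Set.Ioc 0 t₀) t)
    (hbound : ∀ t ∈ Set.Ioc 0 t₀, ‖f' t‖ ≤ C * t ^ (p - 1))
    {s t : ℝ} (hs : 0 < s) (hst : s ≤ t) (ht : t ≤ t₀) :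
    ‖f t - f s‖ ≤ C / p * t ^ p - C / p * s ^ p := by
  have hsub : Set.Icc s t ⊆ Set.Ioc 0 t₀ := fun x hx => ⟨hs.trans_le hx.1, hx.2.trans ht⟩
  have hB : ∀ x ∈ Set.Icc s t,
      HasDerivAt (fun y : ℝ => C / p * y ^ p - C / p * s ^ p) (C * x ^ (p - 1)) x := by
    intro x hx
    have h := ((Real.hasDerivAt_rpow_const (p := p)
      (Or.inl (hsub hx).1.ne')).const_mul (C / p)).sub_const (C / p * s ^ p)
    rwa [← mul_assoc, div_mul_cancel₀ C hp.ne'] at h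
  refine image_norm_le_of_norm_deriv_right_le_deriv_boundary' (f := fun x => f x - f s)
    (f' := f') (fun x hx => ?_) (fun x hx => ?_) (by simp)
    (fun x hx => (hB x hx).continuousAt.continuousWithinAt)
    (fun x hx => (hB x (Set.Ico_subset_Icc_self hx)).hasDerivWithinAt)
    (fun x hx => hbound x (hsub (Set.Ico_subset_Icc_self hx))) (Set.right_mem_Icc.2 hst)
  · exact ((hf x (hsub hx)).continuousWithinAt.mono hsub).sub continuousWithinAt_const
  · refine ((hf x (hsub (Set.Ico_subset_Icc_self hx))).sub_const (f s)).mono_of_mem_nhdsWithin ?_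
    filter_upwards [Icc_mem_nhdsGE hx.2] with y hy
    exact hsub ⟨hx.1.trans hy.1, hy.2⟩

/-- A function on `(0, t₀]` whose derivative is bounded by `C * t ^ (p - 1)` with `0 < p`
converges as `t ↓ 0`, at rate `t ^ p`. -/
lemma exists_tendsto_of_norm_deriv_le_rpow [CompleteSpace E] (ht₀ : 0 < t₀) (hp : 0 < p)
    (hf : ∀ t ∈ Set.Ioc 0 t₀, HasDerivWithinAt f (f' t) (Set.Ioc 0 t₀) t)
    (hbound : ∀ t ∈ Set.Ioc 0 t₀, ‖f' t‖ ≤ C * t ^ (p - 1)) :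
    ∃ a, Tendsto f (𝓝[>] 0) (𝓝 a) ∧ ∀ t ∈ Set.Ioc 0 t₀, ‖f t - a‖ ≤ C / p * t ^ p := by
  have hpow : Tendsto (fun t : ℝ => C / p * t ^ p) (𝓝[>] 0) (𝓝 0) := by
    have h := ((Real.continuousAt_rpow_const 0 p (Or.inr hp.le)).tendsto.const_mul (C / p))
    rw [Real.zero_rpow hp.ne', mul_zero] at h
    exact h.mono_left nhdsWithin_le_nhds
  have hev : ∀ᶠ t in 𝓝[>] (0 : ℝ), t ∈ Set.Ioc 0 t₀ := Ioc_mem_nhdsGT ht₀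
  have hcauchy : Cauchy (map f (𝓝[>] 0)) := by
    rw [cauchy_map_iff']
    refine tendsto_uniformity_iff_dist_tendsto_zero.2 ?_
    have hlim := (hpow.comp tendsto_fst).dist (hpow.comp (tendsto_snd (f := 𝓝[>] (0 : ℝ))))
    rw [dist_self] at hlim
    refine squeeze_zero' (.of_forall fun _ => dist_nonneg) ?_ hlim
    filter_upwards [hev.prod_mk hev] with x ⟨h₁, h₂⟩
    simp only [Function.comp_apply]
    rcases le_total x.1 x.2 with h | h
    · rw [dist_comm, dist_eq_norm, dist_comm, Real.dist_eq]
      exact (norm_sub_le_of_norm_deriv_le_rpow hp hf hbound h₁.1 h h₂.2).trans (le_abs_self _)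
    · rw [dist_eq_norm, Real.dist_eq]
      exact (norm_sub_le_of_norm_deriv_le_rpow hp hf hbound h₂.1 h h₁.2).trans (le_abs_self _)
  obtain ⟨a, ha⟩ := cauchy_map_iff_exists_tendsto.1 hcauchy
  refine ⟨a, ha, fun t ht => ?_⟩
  refine le_of_tendsto_of_tendsto (tendsto_const_nhds.sub ha).norm
    (by simpa using hpow.const_sub (C / p * t ^ p)) ?_
  filter_upwards [Ioc_mem_nhdsGT ht.1] with s hs
  exact norm_sub_le_of_norm_deriv_le_rpow hp hf hbound hs.1 hs.2 ht.2

end PowerDerivativeBound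

/-- Analytic core of Proposition 3.9: a one-parameter family of orthogonal `n × n`
real matrices on `(0, t₀]` whose time derivative is bounded entrywise by
`C * t ^ (2δ - 1)` converges, as `t ↓ 0`, with rate `t ^ (2δ)`, to an orthogonal
matrix. -/
theorem stmt_3 (n : ℕ) (hn : 1 ≤ n) (t₀ δ C : ℝ) (ht₀ : 0 < t₀) (hδ : 0 < δ)
    (hC : 0 ≤ C)
    (A A' : ℝ → Matrix (Fin n) (Fin n) ℝ)
    (hderiv : ∀ t ∈ Set.Ioc 0 t₀, ∀ I J : Fin n,
      HasDerivWithinAt (fun s => A s I J) (A' t I J) (Set.Ioc 0 t₀) t)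
    (horth : ∀ t ∈ Set.Ioc 0 t₀, (A t)ᵀ * A t = 1)
    (hbound : ∀ t ∈ Set.Ioc 0 t₀, ∀ I J : Fin n,
      |A' t I J| ≤ C * t ^ (2 * δ - 1)) :
    ∃ A₀ : Matrix (Fin n) (Fin n) ℝ, A₀ᵀ * A₀ = 1 ∧
      ∀ t ∈ Set.Ioc 0 t₀, ∀ I J : Fin n,
        |A t I J - A₀ I J| ≤ (C / (2 * δ)) * t ^ (2 * δ) := by
  choose A₀ hlim hrate using fun I J : Fin n =>
    exists_tendsto_of_norm_deriv_le_rpow (p := 2 * δ) ht₀ (by positivity)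
      (fun t ht => hderiv t ht I J) (fun t ht => hbound t ht I J)
  refine ⟨of A₀, ?_, fun t ht I J => hrate I J t ht⟩
  have hA : Tendsto A (𝓝[>] 0) (𝓝 (of A₀)) :=
    tendsto_pi_nhds.2 fun I => tendsto_pi_nhds.2 fun J => hlim I J
  have hcont : Continuous fun M : Matrix (Fin n) (Fin n) ℝ => Mᵀ * M := by fun_prop
  have hprod : Tendsto (fun t => (A t)ᵀ * A t) (𝓝[>] 0) (𝓝 ((of A₀)ᵀ * of A₀)) :=
    (hcont.tendsto (of A₀)).comp hA
  refine tendsto_nhds_unique hprod (tendsto_const_nhds.congr' ?_)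
  filter_upwards [Ioc_mem_nhdsGT ht₀] with t ht using (horth t ht).symm
end
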